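/- Suppose H ∈ C^∞(ℝ²) satisfies (H1')&(H2). Let U ⊆ ℝ² be a domain, ε ∈ (0,1], and let u^ε ∈ C^∞(U) satisfy 𝒜_H[u^ε] + ε·div(D_pH(Du^ε)) = 0 in U. Then the function x ↦ [H(Du^ε(x))]^{1/2} is locally Lipschitz on U, and at every point x ∈ U at which [H(Du^ε)]^{1/2} is differentiable one has (−det D²u^ε)·det(D²H(Du^ε)) = 4·τ̃_H(Du^ε)·⟨D²H(Du^ε)·D[H(Du^ε)]^{1/2}, D[H(Du^ε)]^{1/2}⟩ + τ̃_H(Du^ε)·ε·(div(D_pH(Du^ε)))²/H(Du^ε), with the convention that (div(D_pH(Du^ε)))²/H(Du^ε) := 0 at points where D_pH(Du^ε) = 0. In particular −det D²u^ε ≥ 0 everywhere in U. -/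

import Mathlib

open MeasureTheory Set Filter Topology Metric Bornology
open scoped Classical ENNReal NNReal

noncomputable section

/-- The Euclidean plane `ℝ²`. -/
abbrev E2 := EuclideanSpace ℝ (Fin 2)

/-- `i`-th standard coordinate vector of `ℝ²`. -/
def e2 (i : Fin 2) : E2 := EuclideanSpace.single i 1

/-- The partial derivative `∂f/∂xᵢ` (via the total Fréchet derivative; junk value `0`
where `f` is not differentiable). -/
def pd (f : E2 → ℝ) (i : Fin 2) (x : E2) : ℝ := fderiv ℝ f x (e2 i)

/-- The gradient of `f` as a vector in `Fin 2 → ℝ`. -/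
def gradV (f : E2 → ℝ) (x : E2) : Fin 2 → ℝ := fun i => pd f i x

/-- The gradient of `f` as an element of `ℝ²`. -/
def gradE (f : E2 → ℝ) (x : E2) : E2 := (EuclideanSpace.equiv (Fin 2) ℝ).symm (gradV f x)

/-- Second partial derivative `∂ᵢ∂ⱼ f`. -/
def pd2 (f : E2 → ℝ) (i j : Fin 2) (x : E2) : ℝ := pd (fun y => pd f j y) i x

/-- Hessian matrix of `f` at `x`. -/
def hessM (f : E2 → ℝ) (x : E2) : Matrix (Fin 2) (Fin 2) ℝ := Matrix.of fun i j => pd2 f i j x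

/-- Operator norm of the second derivative of `f` at `x`. -/
def hessNorm (f : E2 → ℝ) (x : E2) : ℝ := ‖fderiv ℝ (fderiv ℝ f) x‖

/-- Euclidean norm of a vector in `Fin 2 → ℝ`. -/
def vnorm (a : Fin 2 → ℝ) : ℝ := Real.sqrt (∑ i, a i ^ 2)

/-- The Aronsson operator `𝒜_H[v] = Σ_{i,j} H_{p_i}(Dv) H_{p_j}(Dv) v_{x_i x_j}`. -/
def aronsson (H v : E2 → ℝ) (x : E2) : ℝ :=
  ∑ i, ∑ j, pd H i (gradE v x) * pd H j (gradE v x) * pd2 v i j x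

/-- `div (D_pH(Dv))`. -/
def divDpH (H v : E2 → ℝ) (x : E2) : ℝ := ∑ i, pd (fun y => pd H i (gradE v y)) i x

/-- The `L^∞` norm (essential supremum) of `f` on `V`. -/
def supNorm (f : E2 → ℝ) (V : Set E2) : ℝ := (eLpNorm f ⊤ (volume.restrict V)).toReal

/-- The supremum norm of `f` on `K`. -/
def supAbs (K : Set E2) (f : E2 → ℝ) : ℝ := sSup ((fun x => |f x|) '' K)

/-- The `L^q` norm of `f` on `V`. -/
def lpNorm (q : ℝ) (V : Set E2) (f : E2 → ℝ) : ℝ := (∫ x in V, |f x| ^ q) ^ (1 / q)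

/-- The integral average `⨍_V f`. -/
def avgOn (V : Set E2) (f : E2 → ℝ) : ℝ := (volume V).toReal⁻¹ * ∫ x in V, f x

/-- Distance between two sets. -/
def setDist (s t : Set E2) : ℝ := sInf {d : ℝ | ∃ x ∈ s, ∃ y ∈ t, d = dist x y}

/-- `f` is locally Lipschitz on `O`. -/
def LocLipOn (O : Set E2) (f : E2 → ℝ) : Prop :=
  ∀ x ∈ O, ∃ K : ℝ≥0, ∃ t ∈ 𝓝[O] x, LipschitzOnWith K f t

/-- `u` is an absolute minimizer for the Hamiltonian `H` in `Ω`. -/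
def IsAbsMin (H : E2 → ℝ) (Ω : Set E2) (u : E2 → ℝ) : Prop :=
  LocLipOn Ω u ∧
  ∀ V : Set E2, IsOpen V → IsBounded V → closure V ⊆ Ω →
    ∀ v : E2 → ℝ, LocLipOn V v → ContinuousOn v (closure V) →
      (∀ x ∈ frontier V, v x = u x) →
      supNorm (fun x => H (gradE u x)) V ≤ supNorm (fun x => H (gradE v x)) V

/-- The hypotheses (H1')&(H2): `H(0) = 0 = min H`, and `H` is globally strongly
convex and strongly concave. -/
def StrongH (H : E2 → ℝ) : Prop :=
  H 0 = 0 ∧ (∀ p, 0 ≤ H p) ∧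
  ∃ lam Lam : ℝ, 0 < lam ∧ lam ≤ Lam ∧
    ConvexOn ℝ univ (fun p => H p - lam / 2 * ‖p‖ ^ 2) ∧
    ConvexOn ℝ univ (fun p => Lam / 2 * ‖p‖ ^ 2 - H p)

/-- The hypotheses (H1)&(H2): `H(0) = 0 = min H`, and `H` is locally strongly
convex and locally strongly concave. -/
def LocStrongH (H : E2 → ℝ) : Prop :=
  H 0 = 0 ∧ (∀ p, 0 ≤ H p) ∧
  ∀ K : Set E2, Convex ℝ K → IsBounded K →
    ∃ lam Lam : ℝ, 0 < lam ∧ 0 < Lam ∧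
      ConvexOn ℝ K (fun p => H p - lam / 2 * ‖p‖ ^ 2) ∧
      ConvexOn ℝ K (fun p => Lam / 2 * ‖p‖ ^ 2 - H p)

/-- `λ_H(∞)`: the supremum of admissible global strong convexity constants. -/
def lamInf (H : E2 → ℝ) : ℝ :=
  sSup {l : ℝ | 0 < l ∧ ConvexOn ℝ univ (fun p => H p - l / 2 * ‖p‖ ^ 2)}

/-- `Λ_H(∞)`: the infimum of admissible global strong concavity constants. -/
def LamInf (H : E2 → ℝ) : ℝ :=
  sInf {L : ℝ | 0 < L ∧ ConvexOn ℝ univ (fun p => L / 2 * ‖p‖ ^ 2 - H p)}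

/-- `λ_H(R)`. -/
def lamR (H : E2 → ℝ) (R : ℝ) : ℝ :=
  ⨆ ε : {t : ℝ // 0 < t},
    sInf {l : ℝ | 0 < l ∧ ConvexOn ℝ (H ⁻¹' Ico 0 (R + ε.1)) (fun p => H p - l / 2 * ‖p‖ ^ 2)}

/-- `Λ_H(R)`. -/
def LamR (H : E2 → ℝ) (R : ℝ) : ℝ :=
  ⨅ ε : {t : ℝ // 0 < t},
    sSup {L : ℝ | 0 < L ∧ ConvexOn ℝ (H ⁻¹' Ico 0 (R + ε.1)) (fun p => L / 2 * ‖p‖ ^ 2 - H p)}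

/-- `τ̃_H(p)`. -/
def tauTilde (H : E2 → ℝ) (p : E2) : ℝ :=
  if p = 0 then 1 / 2
  else H p / ∑ i, (hessM H p)⁻¹.mulVec (gradV H p) i * gradV H p i

/-- `τ_H(R)` for twice differentiable `H`. -/
def tauR (H : E2 → ℝ) (R : ℝ) : ℝ := sInf {t : ℝ | ∃ p : E2, H p ≤ R ∧ t = tauTilde H p}

/-- `τ_H(∞) = lim_{R → ∞} τ_H(R)`. -/
def tauInf (H : E2 → ℝ) : ℝ := ⨅ R : {r : ℝ // 0 ≤ r}, tauR H R.1

/-- A standard mollifier supported in the ball of radius `δ`. -/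
def stdMollifier (δ : ℝ) : E2 → ℝ :=
  if h : 0 < δ then
    (⟨δ / 2, δ, by linarith, by linarith⟩ : ContDiffBump (0 : E2)).normed volume
  else 0

/-- Mollification `η_δ * H`. -/
def mollified (H : E2 → ℝ) (δ : ℝ) (p : E2) : ℝ := ∫ q, stdMollifier δ q * H (p - q)

/-- The unique minimum point `p^δ` of `η_δ * H` (junk value `0` if it does not exist). -/
def minPt (H : E2 → ℝ) (δ : ℝ) : E2 :=
  if h : ∃ p : E2, (∀ q, mollified H δ p ≤ mollified H δ q) ∧
      ∀ p' : E2, (∀ q, mollified H δ p' ≤ mollified H δ q) → p' = p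
  then h.choose else 0

/-- The standard smooth approximation `H^δ(p) = (η_δ*H)(p + p^δ) − (η_δ*H)(p^δ)`. -/
def smoothApprox (H : E2 → ℝ) (δ : ℝ) (p : E2) : ℝ :=
  mollified H δ (p + minPt H δ) - mollified H δ (minPt H δ)

/-- `τ_H(R) = sup_{ε>0} limsup_{δ→0} τ_{H^δ}(R+ε)` for merely continuous `H`. -/
def tauC0 (H : E2 → ℝ) (R : ℝ) : ℝ :=
  ⨆ ε : {t : ℝ // 0 < t},
    Filter.limsup (fun δ => tauR (smoothApprox H δ) (R + ε.1)) (𝓝[>] (0 : ℝ))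

/-- `φ` is a smooth test function with compact support contained in `O`. -/
def IsTestOn (O : Set E2) (φ : E2 → ℝ) : Prop :=
  ContDiff ℝ (⊤ : ℕ∞) φ ∧ HasCompactSupport φ ∧ tsupport φ ⊆ O

/-- `g` is the weak gradient of `f` on `O`. -/
def HasWeakGradOn (O : Set E2) (f : E2 → ℝ) (g : E2 → Fin 2 → ℝ) : Prop :=
  ∀ φ : E2 → ℝ, IsTestOn O φ →
    ∀ i : Fin 2, ∫ x in O, f x * pd φ i x = - ∫ x in O, g x i * φ x

/-- `f ∈ L²_loc(O)`. -/
def MemL2loc (O : Set E2) (f : E2 → ℝ) : Prop :=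
  ∀ V : Set E2, IsOpen V → IsBounded V → closure V ⊆ O →
    IntegrableOn (fun x => f x ^ 2) V volume

/-- `f ∈ W^{1,2}_loc(O)`. -/
def MemW12loc (O : Set E2) (f : E2 → ℝ) : Prop :=
  MemL2loc O f ∧ ∃ g : E2 → Fin 2 → ℝ, HasWeakGradOn O f g ∧
    ∀ i, MemL2loc O (fun x => g x i)

/-- Convergence `f_s → f` in `L^t_loc(O)` for all `t ∈ [1,∞)`, as `s → 0⁺`. -/
def LtLocConv (O : Set E2) (fι : ℝ → E2 → ℝ) (f : E2 → ℝ) : Prop :=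
  ∀ t : ℝ, 1 ≤ t → ∀ V : Set E2, IsOpen V → IsBounded V → closure V ⊆ O →
    Tendsto (fun s => ∫ x in V, |fι s x - f x| ^ t) (𝓝[>] (0 : ℝ)) (𝓝 0)

/-- Weak convergence `f_s → f` in `W^{1,2}_loc(O)` as `s → 0⁺`. -/
def WeakW12locConv (O : Set E2) (fι : ℝ → E2 → ℝ) (f : E2 → ℝ) : Prop :=
  ∃ g : E2 → Fin 2 → ℝ, HasWeakGradOn O f g ∧
  ∃ gι : ℝ → E2 → Fin 2 → ℝ, (∀ s, HasWeakGradOn O (fι s) (gι s)) ∧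
    ∀ V : Set E2, IsOpen V → IsBounded V → closure V ⊆ O →
      Tendsto (fun s => ∫ x in V, (fι s x - f x) ^ 2) (𝓝[>] (0 : ℝ)) (𝓝 0) ∧
      ∀ h : E2 → Fin 2 → ℝ, IntegrableOn (fun x => ∑ i, h x i ^ 2) V volume →
        Tendsto (fun s => ∫ x in V, ∑ i, gι s x i * h x i) (𝓝[>] (0 : ℝ))
          (𝓝 (∫ x in V, ∑ i, g x i * h x i))

/-- `w` solves the Dirichlet problem `div(e^{H(Dw)/ε} D_pH(Dw)) = 0` in `U`, `w = u` on `∂U`. -/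
def ExpSol (H : E2 → ℝ) (U : Set E2) (u : E2 → ℝ) (ε : ℝ) (w : E2 → ℝ) : Prop :=
  ContDiffOn ℝ (⊤ : ℕ∞) w U ∧ ContinuousOn w (closure U) ∧
  (∀ x ∈ U, ∑ i, pd (fun y => Real.exp (H (gradE w y) / ε) * pd H i (gradE w y)) i x = 0) ∧
  ∀ x ∈ frontier U, w x = u x

/-- `U` has a smooth boundary. -/
def SmoothBoundary (U : Set E2) : Prop :=
  ∀ x ∈ frontier U, ∃ V : Set E2, ∃ φ : E2 → ℝ, IsOpen V ∧ x ∈ V ∧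
    ContDiff ℝ (⊤ : ℕ∞) φ ∧ (∀ y ∈ V, fderiv ℝ φ y ≠ 0) ∧ U ∩ V = {y ∈ V | φ y < 0}

/-- The `C^{0,γ}` norm of `f` on `K`. -/
def holderNorm (γ : ℝ) (K : Set E2) (f : E2 → ℝ) : ℝ :=
  supAbs K f + sSup {c : ℝ | ∃ x ∈ K, ∃ y ∈ K, x ≠ y ∧ c = |f x - f y| / dist x y ^ γ}

/-- The normalized density `σ^ε` of `e^{H(Dw)/ε}` over `U`. -/
def sigmaEps (H : E2 → ℝ) (U : Set E2) (w : E2 → ℝ) (ε : ℝ) (x : E2) : ℝ :=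
  Real.exp (H (gradE w x) / ε) / ∫ y in U, Real.exp (H (gradE w y) / ε)

/-- The affine function `x ↦ c + ⟨b, x⟩`. -/
def affF (c : ℝ) (b : Fin 2 → ℝ) (x : E2) : ℝ :=
  c + ∑ i, b i * (EuclideanSpace.equiv (Fin 2) ℝ) x i


lemma hasDerivAt_comp_line {F : E2 → ℝ} (p v : E2) (t : ℝ) (hF : DifferentiableAt ℝ F (p + t • v)) :
    HasDerivAt (fun s : ℝ => F (p + s • v)) (fderiv ℝ F (p + t • v) v) t := by
  have h1 : HasDerivAt (fun s : ℝ => p + s • v) v t := by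
    simpa using ((hasDerivAt_id t).smul_const v).const_add p
  exact hF.hasFDerivAt.comp_hasDerivAt t h1

lemma ConvexOn.comp_line {F : E2 → ℝ} (hF : ConvexOn ℝ univ F) (p v : E2) :
    ConvexOn ℝ univ (fun s : ℝ => F (p + s • v)) := by
  have h := hF.comp_affineMap (AffineMap.lineMap (k := ℝ) p (p + v))
  simpa [Function.comp_def, AffineMap.lineMap_apply, add_comm] using h

/-- The tangent plane of a convex function lies below its graph. -/
lemma ConvexOn.add_fderiv_le {F : E2 → ℝ} (hF : ConvexOn ℝ univ F) (p v : E2)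
    (hd : DifferentiableAt ℝ F p) : F p + fderiv ℝ F p v ≤ F (p + v) := by
  have h1 : HasDerivAt (fun s : ℝ => F (p + s • v)) (fderiv ℝ F p v) 0 := by
    simpa using hasDerivAt_comp_line (F := F) p v 0 (by simpa using hd)
  have h2 := (hF.comp_line p v).le_slope_of_hasDerivAt (mem_univ 0) (mem_univ 1) one_pos h1
  simp [slope_def_field] at h2
  linarith

/-- The quadratic lower bound for a function that stays convex after subtracting a multiple of
the squared norm. -/
lemma ConvexOn.quadratic_le {F : E2 → ℝ} {c : ℝ}
    (hF : ConvexOn ℝ univ (fun p => F p - c / 2 * ‖p‖ ^ 2)) (hd : Differentiable ℝ F) (p v : E2) :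
    F p + fderiv ℝ F p v + c / 2 * ‖v‖ ^ 2 ≤ F (p + v) := by
  have hn := ((hasStrictFDerivAt_norm_sq p).hasFDerivAt).const_mul (c / 2)
  have h1 := (hd p).hasFDerivAt.fun_sub hn
  have h := hF.add_fderiv_le p v h1.differentiableAt
  rw [h1.fderiv, norm_add_sq_real] at h
  simp at h
  linarith

lemma fderiv_pd_apply {F : E2 → ℝ} {x : E2} (hF : DifferentiableAt ℝ (fderiv ℝ F) x)
    (i : Fin 2) (v : E2) : fderiv ℝ (fun y => pd F i y) x v = fderiv ℝ (fderiv ℝ F) x v (e2 i) := by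
  have := hF.hasFDerivAt.clm_apply (hasFDerivAt_const (e2 i) x)
  have h := this.fderiv
  simp only [pd]
  rw [h]; simp

lemma pd2_eq {F : E2 → ℝ} {x : E2} (hF : DifferentiableAt ℝ (fderiv ℝ F) x) (i j : Fin 2) :
    pd2 F i j x = fderiv ℝ (fderiv ℝ F) x (e2 i) (e2 j) := by
  rw [pd2, pd, fderiv_pd_apply hF]

lemma pd2_comm {F : E2 → ℝ} {x : E2} (hF : ContDiffAt ℝ (⊤ : ℕ∞) F x) (i j : Fin 2) :
    pd2 F i j x = pd2 F j i x := by
  have hd : DifferentiableAt ℝ (fderiv ℝ F) x :=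
    (hF.fderiv_right (m := 1) (by norm_cast)).differentiableAt (by simp)
  rw [pd2_eq hd, pd2_eq hd]
  exact (hF.isSymmSndFDerivAt (by simp [minSmoothness_of_isRCLikeNormedField]; norm_cast)).eq _ _

/-- A coordinate expansion in the standard basis of the plane. -/
lemma eq_sum_e2 (v : E2) : v = ∑ i, v i • e2 i := by
  ext j
  fin_cases j <;> simp [e2]

/-- The second derivative of a function that stays convex after subtracting a multiple of the
squared norm is bounded below. -/
lemma ConvexOn.le_fderiv_fderiv {F : E2 → ℝ} {c : ℝ}
    (hF : ConvexOn ℝ univ (fun p => F p - c / 2 * ‖p‖ ^ 2)) (hc : ContDiff ℝ (⊤ : ℕ∞) F)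
    (p v : E2) : c * ‖v‖ ^ 2 ≤ fderiv ℝ (fderiv ℝ F) p v v := by
  have hd : Differentiable ℝ F := hc.differentiable (by simp)
  have hd2 : Differentiable ℝ (fderiv ℝ F) :=
    (hc.fderiv_right (m := 1) (by norm_cast)).differentiable (by simp)
  have hline : ∀ t : ℝ, HasDerivAt (fun s : ℝ => p + s • v) v t := fun t => by
    simpa using ((hasDerivAt_id t).smul_const v).const_add p
  have h1 : ∀ t : ℝ, HasDerivAt (fun s : ℝ => F (p + s • v) - c / 2 * ‖p + s • v‖ ^ 2)
      (fderiv ℝ F (p + t • v) v - c * inner ℝ (p + t • v) v) t := by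
    intro t
    have h := (hasDerivAt_comp_line p v t (hd _)).fun_sub ((hline t).norm_sq.const_mul (c / 2))
    exact h.congr_deriv (by ring)
  have hmono : Monotone
      (fun t : ℝ => fderiv ℝ F (p + t • v) v - c * inner ℝ (p + t • v) v) := by
    have h := (hF.comp_line p v).monotoneOn_deriv (fun t _ => (h1 t).differentiableAt)
    intro s t hst
    have := h (mem_univ s) (mem_univ t) hst
    rwa [(h1 s).deriv, (h1 t).deriv] at this
  have h2 : HasDerivAt (fun t : ℝ => fderiv ℝ F (p + t • v) v - c * inner ℝ (p + t • v) v)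
      (fderiv ℝ (fderiv ℝ F) p v v - c * ‖v‖ ^ 2) 0 := by
    have h3 : DifferentiableAt ℝ (fun y => fderiv ℝ F y v) (p + (0 : ℝ) • v) :=
      (hd2 _).clm_apply (differentiableAt_const _)
    have h4 := hasDerivAt_comp_line p v 0 h3
    have h5 := ((hd2 p).hasFDerivAt.clm_apply (hasFDerivAt_const v p)).fderiv
    simp only [zero_smul, add_zero] at h4
    rw [h5] at h4
    have h6 := ((hline 0).inner ℝ (hasDerivAt_const (0 : ℝ) v)).const_mul c
    have h7 := h4.fun_sub h6
    exact h7.congr_deriv (by simp)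
  have h8 := hmono.deriv_nonneg (x := 0)
  rw [h2.deriv] at h8
  linarith

lemma StrongH.exists_bounds {H : E2 → ℝ} (hS : StrongH H) (hH : ContDiff ℝ (⊤ : ℕ∞) H) :
    ∃ lam Lam : ℝ, 0 < lam ∧ 0 < Lam ∧
      (∀ p v, H p + fderiv ℝ H p v + lam / 2 * ‖v‖ ^ 2 ≤ H (p + v)) ∧
      (∀ p v, H (p + v) ≤ H p + fderiv ℝ H p v + Lam / 2 * ‖v‖ ^ 2) ∧
      ∀ p v, lam * ‖v‖ ^ 2 ≤ fderiv ℝ (fderiv ℝ H) p v v := by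
  obtain ⟨-, -, lam, Lam, hl, hL, h1, h2⟩ := hS
  have hd : Differentiable ℝ H := hH.differentiable (by simp)
  refine ⟨lam, Lam, hl, hl.trans_le hL, h1.quadratic_le hd, fun p v => ?_, h1.le_fderiv_fderiv hH⟩
  have h3 : ConvexOn ℝ univ (fun p => (-H) p - (-Lam) / 2 * ‖p‖ ^ 2) := by
    convert h2 using 2
    simp
    ring
  have h4 := h3.quadratic_le hd.neg p v
  rw [fderiv_neg] at h4
  simp at h4
  linarith

lemma StrongH.fderiv_zero {H : E2 → ℝ} (hS : StrongH H) : fderiv ℝ H 0 = 0 := by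
  refine IsLocalMin.fderiv_eq_zero (Filter.Eventually.of_forall fun p => ?_)
  rw [hS.1]
  exact hS.2.1 p

/-- The square root of `H` is globally Lipschitz. -/
lemma StrongH.exists_lipschitz_sqrt {H : E2 → ℝ} (hS : StrongH H) (hH : ContDiff ℝ (⊤ : ℕ∞) H) :
    ∃ K : ℝ≥0, LipschitzWith K (fun p => Real.sqrt (H p)) := by
  obtain ⟨lam, Lam, -, hL, -, hup, -⟩ := hS.exists_bounds hH
  have hgrad : ∀ p v, fderiv ℝ H p v ^ 2 ≤ 2 * Lam * H p * ‖v‖ ^ 2 := by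
    intro p v
    have hq : ∀ t : ℝ, 0 ≤ Lam / 2 * ‖v‖ ^ 2 * (t * t) + fderiv ℝ H p v * t + H p := by
      intro t
      have h1 := hup p (t • v)
      have h2 := hS.2.1 (p + t • v)
      rw [norm_smul, map_smul, mul_pow, Real.norm_eq_abs, sq_abs, smul_eq_mul] at h1
      linarith
    have := discrim_le_zero hq
    rw [discrim] at this
    linarith
  refine ⟨(Real.sqrt (Lam / 2)).toNNReal, LipschitzWith.of_le_add_mul _ fun q p => ?_⟩
  rw [Real.coe_toNNReal _ (Real.sqrt_nonneg _), dist_eq_norm]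
  set v := q - p with hv
  have hpv : q = p + v := by simp [hv]
  have h1 := hup p v
  have h0 := Real.sq_sqrt (hS.2.1 p)
  have hLs : Real.sqrt (Lam / 2) ^ 2 = Lam / 2 := Real.sq_sqrt (by positivity)
  have hs := Real.sqrt_nonneg (H p)
  have hsL := Real.sqrt_nonneg (Lam / 2)
  rw [hpv]
  refine Real.sqrt_le_iff.2 ⟨by positivity, h1.trans ?_⟩
  have h2 : fderiv ℝ H p v ≤ 2 * (Real.sqrt (H p) * (Real.sqrt (Lam / 2) * ‖v‖)) := by
    refine (abs_le_of_sq_le_sq' ?_ (by positivity)).2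
    refine (hgrad p v).trans_eq ?_
    rw [mul_pow, mul_pow, mul_pow, h0, hLs]
    ring
  nlinarith

lemma ContDiffAt.gradE {f : E2 → ℝ} {x : E2} (hf : ContDiffAt ℝ (⊤ : ℕ∞) f x) :
    ContDiffAt ℝ 1 (gradE f) x := by
  rw [contDiffAt_euclidean]
  intro i
  exact (hf.fderiv_right (m := 1) (by norm_cast)).clm_apply contDiffAt_const

/-- The chain rule for a function of the gradient. -/
lemma pd_comp_gradE {F f : E2 → ℝ} {x : E2} (hf : ContDiffAt ℝ (⊤ : ℕ∞) f x)
    (hF : DifferentiableAt ℝ F (gradE f x)) (j : Fin 2) :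
    pd (fun y => F (gradE f y)) j x = ∑ i, pd F i (gradE f x) * pd2 f j i x := by
  have hg : DifferentiableAt ℝ (gradE f) x := hf.gradE.differentiableAt (by simp)
  have h1 := (hF.hasFDerivAt.comp x hg.hasFDerivAt).fderiv
  have h2 : ∀ i, fderiv ℝ (gradE f) x (e2 j) i = pd2 f j i x := by
    intro i
    have h3 := (hasFDerivWithinAt_univ.1
      (hasFDerivWithinAt_euclidean.1 (hasFDerivWithinAt_univ.2 hg.hasFDerivAt) i)).fderiv
    have h4 := congrArg (fun L => L (e2 j)) h3
    simpa [pd2, pd, gradE, gradV] using h4.symm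
  have h5 : fderiv ℝ (fun y => F (gradE f y)) x
      = (fderiv ℝ F (gradE f x)).comp (fderiv ℝ (gradE f) x) := h1
  rw [pd, h5, ContinuousLinearMap.comp_apply, eq_sum_e2 (fderiv ℝ (gradE f) x (e2 j)), map_sum]
  refine Finset.sum_congr rfl fun i _ => ?_
  rw [map_smul, h2, smul_eq_mul, pd, mul_comm]

lemma StrongH.hessM_pos {H : E2 → ℝ} (hS : StrongH H) (hH : ContDiff ℝ (⊤ : ℕ∞) H) (p : E2) :
    0 < pd2 H 0 0 p ∧ 0 < pd2 H 0 0 p * pd2 H 1 1 p - pd2 H 0 1 p ^ 2 := by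
  obtain ⟨lam, Lam, hl, -, -, -, hpos⟩ := hS.exists_bounds hH
  have hd : DifferentiableAt ℝ (fderiv ℝ H) p :=
    (hH.fderiv_right (m := 1) (by norm_cast)).differentiable (by simp) p
  have h : ∀ x y : ℝ, lam * (x ^ 2 + y ^ 2) ≤
      x ^ 2 * pd2 H 0 0 p + 2 * (x * y) * pd2 H 0 1 p + y ^ 2 * pd2 H 1 1 p := by
    intro x y
    have h1 := hpos p (x • e2 0 + y • e2 1)
    have h2 : ‖x • e2 0 + y • e2 1‖ ^ 2 = x ^ 2 + y ^ 2 := by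
      simp [EuclideanSpace.norm_sq_eq, e2]
    rw [h2] at h1
    simp only [map_add, map_smul, add_apply,
      smul_apply, smul_eq_mul, ← pd2_eq hd,
      pd2_comm hH.contDiffAt 1 0] at h1
    linarith
  have ha : 0 < pd2 H 0 0 p := by
    have := h 1 0
    linarith
  refine ⟨ha, ?_⟩
  have h3 := h (-pd2 H 0 1 p) (pd2 H 0 0 p)
  have h4 : 0 < lam * ((-pd2 H 0 1 p) ^ 2 + pd2 H 0 0 p ^ 2) := by positivity
  refine pos_of_mul_pos_right (lt_of_lt_of_le h4 (h3.trans_eq ?_)) ha.le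
  ring

lemma StrongH.eq_zero_of_gradV_eq_zero {H : E2 → ℝ} (hS : StrongH H)
    (hH : ContDiff ℝ (⊤ : ℕ∞) H) {p : E2} (hp : gradV H p = 0) : p = 0 := by
  obtain ⟨lam, Lam, hl, -, hlow, -, -⟩ := hS.exists_bounds hH
  have h0 : fderiv ℝ H p (-p) = 0 := by
    rw [eq_sum_e2 (-p), map_sum]
    refine Finset.sum_eq_zero fun i _ => ?_
    have : fderiv ℝ H p (e2 i) = 0 := congrFun hp i
    rw [map_smul, this, smul_zero]
  have h1 := hlow p (-p)
  rw [h0, add_neg_cancel, hS.1, norm_neg] at h1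
  have h2 := hS.2.1 p
  have h3 : ‖p‖ ^ 2 ≤ 0 := by nlinarith
  simpa using h3.antisymm (sq_nonneg _)

/-- The Cayley–Hamilton identity behind the determinant formula, with `A = (a, b; b, d)`,
`M = (m, n; n, q)` and the vector `(g, k)`. -/
lemma det_mul_quadratic_form_eq (a b d m n q g k : ℝ) :
    -(m * q - n ^ 2) * (d * g ^ 2 - 2 * b * g * k + a * k ^ 2)
      = (a * (m * g + n * k) ^ 2 + 2 * b * (m * g + n * k) * (n * g + q * k)
          + d * (n * g + q * k) ^ 2)
        - (a * m + 2 * b * n + d * q) * (m * g ^ 2 + 2 * n * g * k + q * k ^ 2) := by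
  ring

lemma quadratic_form_nonneg {a b d : ℝ} (ha : 0 < a) (hdet : 0 < a * d - b ^ 2) (s t : ℝ) :
    0 ≤ a * s ^ 2 + 2 * b * s * t + d * t ^ 2 := by
  refine nonneg_of_mul_nonneg_right (a := a) ?_ ha
  nlinarith [sq_nonneg (a * s + b * t), mul_nonneg hdet.le (sq_nonneg t)]

lemma adjugate_quadratic_form_pos {a b d g k : ℝ} (ha : 0 < a) (hdet : 0 < a * d - b ^ 2)
    (h : g ≠ 0 ∨ k ≠ 0) : 0 < d * g ^ 2 - 2 * b * g * k + a * k ^ 2 := by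
  refine pos_of_mul_pos_right (a := a) ?_ ha.le
  have h1 : a * (d * g ^ 2 - 2 * b * g * k + a * k ^ 2)
      = (a * d - b ^ 2) * g ^ 2 + (a * k - b * g) ^ 2 := by ring
  rw [h1]
  by_cases hg : g = 0
  · have hk : k ≠ 0 := h.resolve_left (not_not_intro hg)
    subst hg
    have : 0 < (a * k) ^ 2 := by positivity
    linarith
  · have : 0 < (a * d - b ^ 2) * g ^ 2 := by positivity
    positivity

lemma det_nonpos_of_trace_mul_eq_zero {a b d m n q : ℝ} (ha : 0 < a) (hdet : 0 < a * d - b ^ 2)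
    (h : a * m + 2 * b * n + d * q = 0) : m * q - n ^ 2 ≤ 0 := by
  have h1 := quadratic_form_nonneg ha hdet n q
  have h2 : a * (m * q - n ^ 2) = -(a * n ^ 2 + 2 * b * n * q + d * q ^ 2) := by
    linear_combination q * h
  by_contra! h3
  nlinarith [mul_pos ha h3]

lemma hessM_det {f : E2 → ℝ} {x : E2} (hf : ContDiffAt ℝ (⊤ : ℕ∞) f x) :
    (hessM f x).det = pd2 f 0 0 x * pd2 f 1 1 x - pd2 f 0 1 x ^ 2 := by
  simp [hessM, Matrix.det_fin_two, pd2_comm hf 1 0, sq]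

lemma aronsson_eq {H f : E2 → ℝ} {x : E2} (hf : ContDiffAt ℝ (⊤ : ℕ∞) f x) :
    aronsson H f x = pd2 f 0 0 x * pd H 0 (gradE f x) ^ 2
      + 2 * pd2 f 0 1 x * pd H 0 (gradE f x) * pd H 1 (gradE f x)
      + pd2 f 1 1 x * pd H 1 (gradE f x) ^ 2 := by
  simp only [aronsson, Fin.sum_univ_two, pd2_comm hf 1 0]
  ring

lemma differentiable_pd {H : E2 → ℝ} (hH : ContDiff ℝ (⊤ : ℕ∞) H) (i : Fin 2) :
    Differentiable ℝ (fun p => pd H i p) :=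
  ((hH.fderiv_right (m := 1) (by norm_cast)).clm_apply contDiff_const).differentiable (by simp)

lemma divDpH_eq {H f : E2 → ℝ} {x : E2} (hH : ContDiff ℝ (⊤ : ℕ∞) H)
    (hf : ContDiffAt ℝ (⊤ : ℕ∞) f x) :
    divDpH H f x = pd2 H 0 0 (gradE f x) * pd2 f 0 0 x
      + 2 * pd2 H 0 1 (gradE f x) * pd2 f 0 1 x + pd2 H 1 1 (gradE f x) * pd2 f 1 1 x := by
  have h : ∀ i, pd (fun y => pd H i (gradE f y)) i x
      = ∑ k, pd2 H k i (gradE f x) * pd2 f i k x := fun i =>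
    pd_comp_gradE hf (differentiable_pd hH i _) i
  simp only [divDpH, h, Fin.sum_univ_two, pd2_comm hf 1 0, pd2_comm hH.contDiffAt 1 0]
  ring

lemma tauTilde_eq {H : E2 → ℝ} (hH : ContDiff ℝ (⊤ : ℕ∞) H) {p : E2} (hp : p ≠ 0) :
    tauTilde H p = H p * (hessM H p).det / (pd2 H 1 1 p * pd H 0 p ^ 2
      - 2 * pd2 H 0 1 p * pd H 0 p * pd H 1 p + pd2 H 0 0 p * pd H 1 p ^ 2) := by
  have h : ∑ i, (hessM H p)⁻¹.mulVec (gradV H p) i * gradV H p i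
      = (hessM H p).det⁻¹ * (pd2 H 1 1 p * pd H 0 p ^ 2
        - 2 * pd2 H 0 1 p * pd H 0 p * pd H 1 p + pd2 H 0 0 p * pd H 1 p ^ 2) := by
    rw [Matrix.inv_def, Matrix.adjugate_fin_two, Ring.inverse_eq_inv', Matrix.smul_mulVec]
    generalize (hessM H p).det⁻¹ = D
    simp [Fin.sum_univ_two, dotProduct, hessM, gradV, pd2_comm hH.contDiffAt 1 0]
    ring
  rw [tauTilde, if_neg hp, h, div_mul_eq_div_div, div_inv_eq_mul]

lemma StrongH.exists_norm_sq_le {H : E2 → ℝ} (hS : StrongH H) (hH : ContDiff ℝ (⊤ : ℕ∞) H) :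
    ∃ lam : ℝ, 0 < lam ∧ ∀ p, lam / 2 * ‖p‖ ^ 2 ≤ H p := by
  obtain ⟨lam, Lam, hl, -, hlow, -, -⟩ := hS.exists_bounds hH
  refine ⟨lam, hl, fun p => ?_⟩
  simpa [hS.1, hS.fderiv_zero] using hlow 0 p

lemma StrongH.pos {H : E2 → ℝ} (hS : StrongH H) (hH : ContDiff ℝ (⊤ : ℕ∞) H) {p : E2}
    (hp : p ≠ 0) : 0 < H p := by
  obtain ⟨lam, hl, h⟩ := hS.exists_norm_sq_le hH
  have : 0 < ‖p‖ := norm_pos_iff.2 hp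
  exact lt_of_lt_of_le (by positivity) (h p)

lemma pd_sqrt {H : E2 → ℝ} {p : E2} (hH : DifferentiableAt ℝ H p) (hp : H p ≠ 0) (i : Fin 2) :
    pd (fun q => Real.sqrt (H q)) i p = pd H i p / (2 * Real.sqrt (H p)) := by
  simp only [pd]
  rw [(hH.hasFDerivAt.sqrt hp).fderiv, smul_apply, smul_eq_mul]
  ring

/-- If `√(H(Df))` is differentiable at a critical point of `f`, then `D²f` vanishes there. -/
lemma StrongH.pd2_eq_zero {H f : E2 → ℝ} {x : E2} (hS : StrongH H) (hH : ContDiff ℝ (⊤ : ℕ∞) H)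
    (hx : gradE f x = 0)
    (hd : DifferentiableAt ℝ (fun y => Real.sqrt (H (gradE f y))) x) :
    gradV (fun y => Real.sqrt (H (gradE f y))) x = 0 ∧ ∀ i j, pd2 f i j x = 0 := by
  obtain ⟨lam, hl, hlow⟩ := hS.exists_norm_sq_le hH
  have h0 : Real.sqrt (H (gradE f x)) = 0 := by rw [hx, hS.1, Real.sqrt_zero]
  have hmin : fderiv ℝ (fun y => Real.sqrt (H (gradE f y))) x = 0 :=
    IsLocalMin.fderiv_eq_zero (Filter.Eventually.of_forall fun y => by
      simpa only [h0] using Real.sqrt_nonneg _)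
  have hgrad : HasFDerivAt (gradE f) (0 : E2 →L[ℝ] E2) x := by
    have h1 := hd.hasFDerivAt
    rw [hmin] at h1
    rw [hasFDerivAt_iff_isLittleO] at h1 ⊢
    refine Asymptotics.IsBigO.trans_isLittleO ?_ h1
    refine Asymptotics.IsBigO.of_bound (Real.sqrt (lam / 2))⁻¹ (Filter.Eventually.of_forall ?_)
    intro y
    have hs : 0 < Real.sqrt (lam / 2) := Real.sqrt_pos.2 (by positivity)
    have h2 := Real.sqrt_le_sqrt (hlow (gradE f y))
    rw [Real.sqrt_mul (by positivity), Real.sqrt_sq (norm_nonneg _)] at h2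
    simp only [hx, hS.1, Real.sqrt_zero, sub_zero, zero_apply, Real.norm_eq_abs,
      abs_of_nonneg (Real.sqrt_nonneg _)]
    rwa [← div_eq_inv_mul, le_div_iff₀' hs]
  refine ⟨funext fun i => by simp [gradV, pd, hmin], fun i j => ?_⟩
  have h3 := (hasFDerivWithinAt_univ.1
      (hasFDerivWithinAt_euclidean.1 (hasFDerivWithinAt_univ.2 hgrad) j)).fderiv
  have h4 := congrArg (fun L => L (e2 i)) h3
  simpa [pd2, pd, gradE, gradV] using h4

/-- The determinant identity at a noncritical point. -/
lemma StrongH.det_identity {H f : E2 → ℝ} {x : E2} {ε : ℝ} (hS : StrongH H)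
    (hH : ContDiff ℝ (⊤ : ℕ∞) H) (hf : ContDiffAt ℝ (⊤ : ℕ∞) f x) (hx : gradE f x ≠ 0)
    (heq : aronsson H f x + ε * divDpH H f x = 0) :
    (-(hessM f x).det) * (hessM H (gradE f x)).det
      = 4 * tauTilde H (gradE f x) *
          (∑ i, (hessM H (gradE f x)).mulVec
              (gradV (fun y => Real.sqrt (H (gradE f y))) x) i *
            gradV (fun y => Real.sqrt (H (gradE f y))) x i)
        + tauTilde H (gradE f x) * ε * ((divDpH H f x) ^ 2 / H (gradE f x)) := by
  have hpos := hS.pos hH hx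
  have hHd : DifferentiableAt ℝ H (gradE f x) := hH.differentiable (by simp) _
  have hgrad : ∀ j, gradV (fun y => Real.sqrt (H (gradE f y))) x j
      = (pd2 f j 0 x * pd H 0 (gradE f x) + pd2 f j 1 x * pd H 1 (gradE f x))
        / (2 * Real.sqrt (H (gradE f x))) := by
    intro j
    rw [gradV, pd_comp_gradE (F := fun q => Real.sqrt (H q)) hf (hHd.sqrt hpos.ne')]
    simp only [pd_sqrt hHd hpos.ne', Fin.sum_univ_two]
    ring
  have hgk : pd H 0 (gradE f x) ≠ 0 ∨ pd H 1 (gradE f x) ≠ 0 := by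
    by_contra! h
    refine hx (hS.eq_zero_of_gradV_eq_zero hH (funext fun i => ?_))
    fin_cases i
    exacts [h.1, h.2]
  obtain ⟨ha, hdet⟩ := hS.hessM_pos hH (gradE f x)
  have hD := adjugate_quadratic_form_pos ha hdet hgk
  have hsum : ∑ i, (hessM H (gradE f x)).mulVec
      (gradV (fun y => Real.sqrt (H (gradE f y))) x) i *
        gradV (fun y => Real.sqrt (H (gradE f y))) x i
      = (pd2 H 0 0 (gradE f x) * (pd2 f 0 0 x * pd H 0 (gradE f x)
            + pd2 f 0 1 x * pd H 1 (gradE f x)) ^ 2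
          + 2 * pd2 H 0 1 (gradE f x) * (pd2 f 0 0 x * pd H 0 (gradE f x)
            + pd2 f 0 1 x * pd H 1 (gradE f x)) * (pd2 f 0 1 x * pd H 0 (gradE f x)
            + pd2 f 1 1 x * pd H 1 (gradE f x))
          + pd2 H 1 1 (gradE f x) * (pd2 f 0 1 x * pd H 0 (gradE f x)
            + pd2 f 1 1 x * pd H 1 (gradE f x)) ^ 2) / (4 * H (gradE f x)) := by
    have hsq : 4 * H (gradE f x) = (2 * Real.sqrt (H (gradE f x))) ^ 2 := by
      rw [mul_pow, Real.sq_sqrt hpos.le]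
      norm_num
    simp only [Fin.sum_univ_two, Matrix.mulVec, dotProduct, hgrad, hessM, Matrix.of_apply,
      pd2_comm hf 1 0, pd2_comm hH.contDiffAt 1 0, hsq]
    ring
  have hkey := det_mul_quadratic_form_eq (pd2 H 0 0 (gradE f x)) (pd2 H 0 1 (gradE f x))
    (pd2 H 1 1 (gradE f x)) (pd2 f 0 0 x) (pd2 f 0 1 x) (pd2 f 1 1 x)
    (pd H 0 (gradE f x)) (pd H 1 (gradE f x))
  rw [hsum, tauTilde_eq hH hx, hessM_det hf, hessM_det hH.contDiffAt]
  rw [← divDpH_eq hH hf, show pd2 f 0 0 x * pd H 0 (gradE f x) ^ 2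
      + 2 * pd2 f 0 1 x * pd H 0 (gradE f x) * pd H 1 (gradE f x)
      + pd2 f 1 1 x * pd H 1 (gradE f x) ^ 2 = -(ε * divDpH H f x) by
        rw [← aronsson_eq hf]; linarith] at hkey
  generalize pd2 H 1 1 (gradE f x) * pd H 0 (gradE f x) ^ 2
    - 2 * pd2 H 0 1 (gradE f x) * pd H 0 (gradE f x) * pd H 1 (gradE f x)
    + pd2 H 0 0 (gradE f x) * pd H 1 (gradE f x) ^ 2 = D at hD hkey ⊢
  field_simp
  linear_combination hkey

lemma StrongH.tauTilde_nonneg {H : E2 → ℝ} (hS : StrongH H) (hH : ContDiff ℝ (⊤ : ℕ∞) H)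
    (p : E2) : 0 ≤ tauTilde H p := by
  obtain ⟨ha, hdet⟩ := hS.hessM_pos hH p
  by_cases hp : p = 0
  · simp [tauTilde, hp]
  · rw [tauTilde_eq hH hp, hessM_det hH.contDiffAt]
    have h := quadratic_form_nonneg ha hdet (-pd H 1 p) (pd H 0 p)
    exact div_nonneg (mul_nonneg (hS.2.1 p) hdet.le) (by linarith)

lemma StrongH.det_hessM_nonpos {H f : E2 → ℝ} {x : E2} {ε : ℝ} (hS : StrongH H)
    (hH : ContDiff ℝ (⊤ : ℕ∞) H) (hf : ContDiffAt ℝ (⊤ : ℕ∞) f x) (hε : 0 < ε)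
    (heq : aronsson H f x + ε * divDpH H f x = 0) : (hessM f x).det ≤ 0 := by
  obtain ⟨ha, hdet⟩ := hS.hessM_pos hH (gradE f x)
  by_cases hx : gradE f x = 0
  · have hg : ∀ i, pd H i (gradE f x) = 0 := by simp [pd, hx, hS.fderiv_zero]
    rw [aronsson_eq hf, hg, hg, divDpH_eq hH hf] at heq
    rw [hessM_det hf]
    refine det_nonpos_of_trace_mul_eq_zero ha hdet ?_
    simpa [hε.ne'] using heq
  · have h := hS.det_identity hH hf hx heq
    have hτ := hS.tauTilde_nonneg hH (gradE f x)
    have hp := hS.2.1 (gradE f x)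
    set V := gradV (fun y => Real.sqrt (H (gradE f y))) x
    have hsum : 0 ≤ ∑ i, (hessM H (gradE f x)).mulVec V i * V i := by
      refine (quadratic_form_nonneg ha hdet (V 0) (V 1)).trans_eq ?_
      simp only [Fin.sum_univ_two, Matrix.mulVec, dotProduct, hessM, Matrix.of_apply,
        pd2_comm hH.contDiffAt 1 0]
      ring
    have h1 : 0 ≤ -(hessM f x).det * (hessM H (gradE f x)).det := by
      rw [h]
      positivity
    rw [hessM_det hH.contDiffAt] at h1
    linarith [nonneg_of_mul_nonneg_left h1 hdet]

/-- key identity for `−det D²u^ε`, Theorem 2.3. -/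
theorem statement2
    (H : E2 → ℝ) (hH : ContDiff ℝ (⊤ : ℕ∞) H) (hS : StrongH H)
    (U : Set E2) (hUopen : IsOpen U) (hUconn : IsConnected U)
    (ε : ℝ) (hε : ε ∈ Ioc (0 : ℝ) 1)
    (w : E2 → ℝ) (hw : ContDiffOn ℝ (⊤ : ℕ∞) w U)
    (heq : ∀ x ∈ U, aronsson H w x + ε * divDpH H w x = 0) :
    LocLipOn U (fun x => Real.sqrt (H (gradE w x))) ∧
    (∀ x ∈ U, DifferentiableAt ℝ (fun y => Real.sqrt (H (gradE w y))) x →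
      (-(hessM w x).det) * (hessM H (gradE w x)).det
      = 4 * tauTilde H (gradE w x) *
          (∑ i, (hessM H (gradE w x)).mulVec
              (gradV (fun y => Real.sqrt (H (gradE w y))) x) i *
            gradV (fun y => Real.sqrt (H (gradE w y))) x i)
        + tauTilde H (gradE w x) * ε *
          (if gradV H (gradE w x) = 0 then 0
           else (divDpH H w x) ^ 2 / H (gradE w x))) ∧
    ∀ x ∈ U, 0 ≤ -(hessM w x).det := by
  have hwx : ∀ x ∈ U, ContDiffAt ℝ (⊤ : ℕ∞) w x := fun x hx =>
    hw.contDiffAt (hUopen.mem_nhds hx)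
  refine ⟨fun x hx => ?_, fun x hx hd => ?_, fun x hx => ?_⟩
  · obtain ⟨K, t, ht, hK⟩ := (hwx x hx).gradE.exists_lipschitzOnWith
    obtain ⟨L, hL⟩ := hS.exists_lipschitz_sqrt hH
    exact ⟨L * K, t, mem_nhdsWithin_of_mem_nhds ht, hL.comp_lipschitzOnWith hK⟩
  · by_cases hp : gradE w x = 0
    · obtain ⟨hV, hM⟩ := hS.pd2_eq_zero hH hp hd
      have hg : gradV H (gradE w x) = 0 := funext fun i => by
        simp [gradV, pd, hp, hS.fderiv_zero]
      rw [if_pos hg, hV, hessM_det (hwx x hx), hM, hM, hM]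
      simp
    · rw [if_neg (fun h => hp (hS.eq_zero_of_gradV_eq_zero hH h))]
      exact hS.det_identity hH (hwx x hx) hp (heq x hx)
  · exact neg_nonneg.2 (hS.det_hessM_nonpos hH (hwx x hx) hε.1 (heq x hx))

end
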